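/- (Post's coset theorem) Let n ≥ 2 and let (G, f) be an n-ary group. Then there exist a group G*, an injective map ι : G → G*, and a normal subgroup K of G* such that: (1) ι(G) is a coset of K in G*; (2) K is isomorphic as a group to the retract ret_a(G, f) for some a ∈ G; (3) the quotient group G*/K is cyclic of order n−1; (4) ι(f(x₁,...,xₙ)) = ι(x₁)·ι(x₂)·…·ι(xₙ) in G* for all x₁,...,xₙ ∈ G; and (5) ι(G) generates G* as a group. -/

import Mathlib

universe u

open Pointwise

/-- Associativity of an `n`-ary operation: inserting the inner `f` at position `i`
(0-indexed) of the sequence `x₀, …, x_{2n-2}` gives the same result for all positions. -/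
def PolyAssoc (n : ℕ) {G : Type*} (f : (Fin n → G) → G) : Prop :=
  ∀ i j : ℕ, i ≤ j → j < n → ∀ x : ℕ → G,
    f (fun t : Fin n =>
        if (t : ℕ) < i then x (t : ℕ)
        else if (t : ℕ) = i then f (fun s : Fin n => x (i + (s : ℕ)))
        else x ((t : ℕ) + n - 1)) =
    f (fun t : Fin n =>
        if (t : ℕ) < j then x (t : ℕ)
        else if (t : ℕ) = j then f (fun s : Fin n => x (j + (s : ℕ)))
        else x ((t : ℕ) + n - 1))

/-- Unique solvability of one-variable linear equations for an `n`-ary operation. -/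
def PolySolv (n : ℕ) {G : Type*} (f : (Fin n → G) → G) : Prop :=
  ∀ (a : Fin n → G) (c : G) (i : Fin n), ∃! x : G, f (Function.update a i x) = c

/-- `(G, f)` is an `n`-ary (polyadic) group. -/
def IsPolyadicGroup (n : ℕ) {G : Type*} (f : (Fin n → G) → G) : Prop :=
  PolyAssoc n f ∧ PolySolv n f

/-- The binary operation of the retract of `(G, f)` over `a`:
`x ∙ y = f(x, a, …, a, y)` (with `n-2` copies of `a`). -/
def retMul (n : ℕ) {G : Type*} (f : (Fin n → G) → G) (a x y : G) : G :=
  f (fun t : Fin n => if (t : ℕ) = 0 then x else if (t : ℕ) = n - 1 then y else a)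

/-- A Post cover of an `n`-ary group `(G, f)`: a group `Gs` containing (a copy of) `G`
as a coset of a normal subgroup `K` isomorphic to a retract of `(G,f)`, with cyclic
quotient of order `n-1`, on which `f` is the iterated group product, and generated
by the copy of `G`. -/
structure PostCover (n : ℕ) (G : Type u) (f : (Fin n → G) → G) where
  Gs : Type u
  [grp : Group Gs]
  ι : G → Gs
  inj : Function.Injective ι
  K : Subgroup Gs
  [normal : K.Normal]
  /-- `ι(G)` is a coset of `K` in `Gs`. -/
  coset : ∃ g : Gs, Set.range ι = g • (K : Set Gs)
  /-- `K` is isomorphic (as a group) to a retract of `(G, f)`. -/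
  retractIso : ∃ (a : G) (e : G ≃ K), ∀ x y : G, e (retMul n f a x y) = e x * e y
  /-- `Gs/K` is cyclic of order `n - 1`. -/
  cyclicQuot : Nonempty ((Gs ⧸ K) ≃* Multiplicative (ZMod (n - 1)))
  /-- inside `Gs`, `f(x₁,…,xₙ) = x₁ ∘ x₂ ∘ ⋯ ∘ xₙ`. -/
  mulForm : ∀ x : Fin n → G, ι (f x) = (List.ofFn fun i : Fin n => ι (x i)).prod
  /-- `Gs` is generated by `ι(G)`. -/
  generates : Subgroup.closure (Set.range ι) = ⊤

section PostAux

variable {G : Type u} (m : ℕ) (f : (Fin (m+1) → G) → G) (a : G)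

/-- `f` evaluated on a list (with default entry `a`). -/
def postF (l : List G) : G := f (fun t => l.getD (t : ℕ) a)

/-- Long product of a list, collapsing the first `m+1` entries repeatedly. -/
def postP (l : List G) : G :=
  if h : 1 ≤ m ∧ m + 1 ≤ l.length then
    postP (postF m f a (l.take (m+1)) :: l.drop (m+1))
  else l.getD 0 a
termination_by l.length
decreasing_by simp; omega

theorem postF_assoc (hA : PolyAssoc (m+1) f) (p x s : List G)
    (hp : p.length + s.length = m) (hx : x.length = m + 1) :
    postF m f a (p ++ postF m f a x :: s) =
      postF m f a (postF m f a ((p ++ x ++ s).take (m+1)) :: (p ++ x ++ s).drop (m+1)) := by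
  have h := hA 0 p.length (Nat.zero_le _) (by omega) (fun k => (p ++ x ++ s).getD k a)
  have e1 : postF m f a ((p ++ x ++ s).take (m+1)) =
      f (fun s' : Fin (m+1) => (p ++ x ++ s).getD (0 + (s' : ℕ)) a) := by
    unfold postF
    congr 1
    funext t
    have := t.2
    simp only [List.getD_eq_getElem?_getD, List.getElem?_take]
    simp [this]
  have e2 : postF m f a x =
      f (fun s' : Fin (m+1) => (p ++ x ++ s).getD (p.length + (s' : ℕ)) a) := by
    unfold postF
    congr 1
    funext t
    have := t.2
    simp only [List.getD_eq_getElem?_getD, List.append_assoc]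
    rw [List.getElem?_append_right (by omega), List.getElem?_append_left (by omega)]
    simp
  rw [← e1, ← e2] at h
  generalize postF m f a ((p ++ x ++ s).take (m+1)) = A at h ⊢
  generalize postF m f a x = B at h ⊢
  unfold postF
  refine Eq.trans ?_ (h.symm.trans ?_)
  · congr 1
    funext t
    have := t.2
    simp only [List.getD_eq_getElem?_getD]
    split_ifs with h1 h2
    · rw [List.append_assoc, List.getElem?_append_left h1, List.getElem?_append_left h1]
    · rw [List.getElem?_append_right (by omega), h2]; simp
    · rw [List.getElem?_append_right (by omega), List.getElem?_append_right (by simp; omega)]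
      obtain ⟨k, hk⟩ : ∃ k, (t : ℕ) - p.length = k + 1 := ⟨t - p.length - 1, by omega⟩
      rw [hk, List.getElem?_cons_succ]
      congr 2
      simp; omega
  · congr 1
    funext t
    have := t.2
    simp only [List.getD_eq_getElem?_getD]
    split_ifs with h1 h2
    · omega
    · rw [h2]; simp
    · obtain ⟨k, hk⟩ : ∃ k, (t : ℕ) = k + 1 := ⟨t - 1, by omega⟩
      rw [hk, List.getElem?_cons_succ, List.getElem?_drop]
      congr 2
      omega

theorem postP_collapse0 (hm : 1 ≤ m) (x s : List G) (hx : x.length = m + 1) :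
    postP m f a (x ++ s) = postP m f a (postF m f a x :: s) := by
  rw [postP, dif_pos ⟨hm, by simp; omega⟩]
  rw [List.take_left' hx, List.drop_left' hx]

theorem postP_collapse (hm : 1 ≤ m) (hA : PolyAssoc (m+1) f) (x : List G)
    (hx : x.length = m + 1) (N : ℕ) : ∀ (p s : List G), p.length = N →
    m ∣ p.length + s.length →
    postP m f a (p ++ x ++ s) = postP m f a (p ++ postF m f a x :: s) := by
  induction N using Nat.strong_induction_on with
  | _ N ih =>
  intro p s hN hd
  rcases Nat.eq_zero_or_pos p.length with h0 | h0
  · have : p = [] := List.length_eq_zero_iff.mp h0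
    subst this
    simpa using postP_collapse0 m f a hm x s hx
  have hle := Nat.le_of_dvd (by omega) hd
  by_cases hp : m + 1 ≤ p.length
  · obtain ⟨p1, p2, rfl, h1⟩ : ∃ p1 p2, p = p1 ++ p2 ∧ p1.length = m + 1 :=
      ⟨p.take (m+1), p.drop (m+1), by simp, by simp; omega⟩
    simp only [List.length_append, List.append_assoc] at *
    rw [postP_collapse0 m f a hm p1 _ h1, postP_collapse0 m f a hm p1 _ h1]
    have := ih (p2.length + 1) (by omega) (postF m f a p1 :: p2) s (by simp)
      (by
        have : p1.length + p2.length + s.length = (p2.length + 1 + s.length) + m := by omega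
        rw [this] at hd
        simpa using (Nat.dvd_add_left (dvd_refl m)).1 hd)
    simpa using this
  · obtain ⟨s1, s2, rfl, h1⟩ : ∃ s1 s2, s = s1 ++ s2 ∧ s1.length + p.length = m :=
      ⟨s.take (m - p.length), s.drop (m - p.length), by simp, by simp; omega⟩
    have hl : p ++ x ++ (s1 ++ s2) = (p ++ x ++ s1).take (m+1) ++
        ((p ++ x ++ s1).drop (m+1) ++ s2) := by
      rw [← List.append_assoc ((p ++ x ++ s1).take (m+1)), List.take_append_drop]; simp
    rw [hl, postP_collapse0 m f a hm _ _ (by simp; omega)]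
    have hr : p ++ postF m f a x :: (s1 ++ s2) = (p ++ postF m f a x :: s1) ++ s2 := by simp
    rw [hr, postP_collapse0 m f a hm _ s2 (by simp; omega),
      postF_assoc m f a hA p x s1 (by omega) hx, ← List.cons_append,
      postP_collapse0 m f a hm _ s2 (by simp; omega)]

/-- Contextual congruence. -/
def postCon (k : ℕ) : Con (FreeMonoid G) where
  r u v := u.toList.length ≡ v.toList.length [MOD m] ∧
    ∀ p s : List G, k ≤ p.length →
      p.length + u.toList.length + s.length ≡ 1 [MOD m] →
      postP m f a (p ++ u.toList ++ s) = postP m f a (p ++ v.toList ++ s)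
  iseqv := {
    refl := fun u => ⟨rfl, fun _ _ _ _ => rfl⟩
    symm := fun {u v} h => ⟨h.1.symm, fun p s hp hs => (h.2 p s hp
      (((h.1.add_left _).add_right _).trans hs)).symm⟩
    trans := fun {u v w} h h' => ⟨h.1.trans h'.1, fun p s hp hs => (h.2 p s hp hs).trans
      (h'.2 p s hp (((h.1.symm.add_left _).add_right _).trans hs))⟩ }
  mul' := by
    intro w x y z h h'
    refine ⟨by simpa using h.1.add h'.1, fun p s hp hs => ?_⟩
    simp only [FreeMonoid.toList_mul, List.length_append] at *
    have e1 := h.2 p (y.toList ++ s) hp (by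
      simp only [List.length_append]; convert hs using 1; ring)
    have e2 := h'.2 (p ++ x.toList) s (by simp; omega) (by
      simp only [List.length_append]
      refine Nat.ModEq.trans ?_ hs
      rw [← add_assoc p.length]
      exact (((h.1.symm.add_left _).add_right _).add_right _))
    simp only [List.append_assoc] at *
    exact e1.trans e2

/-- The class of a letter. -/
def postι (k : ℕ) (x : G) : (postCon m f a k).Quotient :=
  (FreeMonoid.of x : FreeMonoid G)

theorem post_coe (k : ℕ) (l : List G) :
    ((FreeMonoid.ofList l : FreeMonoid G) : (postCon m f a k).Quotient) =
      (l.map (postι m f a k)).prod := by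
  induction l with
  | nil => rfl
  | cons x l ih =>
    rw [FreeMonoid.ofList_cons, Con.coe_mul, ih, List.map_cons, List.prod_cons]; rfl

theorem post_mulF (hm : 1 ≤ m) (hA : PolyAssoc (m+1) f) (k : ℕ) (l : List G)
    (hl : l.length = m + 1) :
    postι m f a k (postF m f a l) = (l.map (postι m f a k)).prod := by
  rw [← post_coe]
  refine (Con.eq _).2 ⟨?_, fun p s hp hs => ?_⟩
  · simp [hl, Nat.ModEq]
  · simp only [FreeMonoid.toList_of, FreeMonoid.toList_ofList] at *
    have := postP_collapse m f a hm hA l hl _ p s rfl (by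
      rw [← Nat.modEq_zero_iff_dvd]
      refine Nat.ModEq.add_right_cancel' 1 ?_
      convert hs using 1
      simp; ring)
    rw [this]; simp

theorem postF_ofFn (x : Fin (m+1) → G) : postF m f a (List.ofFn x) = f x := by
  unfold postF
  congr 1
  funext t
  rw [List.getD_eq_getElem?_getD, List.getElem?_ofFn]
  simp [Nat.le_of_lt_succ t.2]

theorem post_mulForm (hm : 1 ≤ m) (hA : PolyAssoc (m+1) f) (k : ℕ) (x : Fin (m+1) → G) :
    postι m f a k (f x) = (List.ofFn fun i => postι m f a k (x i)).prod := by
  rw [← postF_ofFn m f a x, post_mulF m f a hm hA k _ (by simp), List.map_ofFn]; rfl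

theorem post_solve_right (hm : 1 ≤ m) (hf : IsPolyadicGroup (m+1) f) (k : ℕ) (c b : G) :
    ∃ x, postι m f a k c ^ m * postι m f a k x = postι m f a k b := by
  obtain ⟨x, hx, -⟩ := hf.2 (fun _ => c) b (Fin.last m)
  refine ⟨x, ?_⟩
  rw [← hx, post_mulForm m f a hm hf.1, List.ofFn_succ', List.concat_eq_append, List.prod_append]
  simp [Function.update_of_ne, (Fin.castSucc_lt_last _).ne]

theorem post_solve_left (hm : 1 ≤ m) (hf : IsPolyadicGroup (m+1) f) (k : ℕ) (c b : G) :
    ∃ x, postι m f a k x * postι m f a k c ^ m = postι m f a k b := by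
  obtain ⟨x, hx, -⟩ := hf.2 (fun _ => c) b 0
  refine ⟨x, ?_⟩
  rw [← hx, post_mulForm m f a hm hf.1, List.ofFn_succ, List.prod_cons]
  simp [Function.update_of_ne, Fin.succ_ne_zero]

/-- A word `c^{m-1} e` is trivial. -/
theorem post_one (hm : 1 ≤ m) (hf : IsPolyadicGroup (m+1) f) (c : G) :
    ∃ e, postι m f a 1 c ^ (m-1) * postι m f a 1 e = 1 := by
  obtain ⟨e, he⟩ := post_solve_right m f a hm hf 0 c c
  refine ⟨e, ?_⟩
  have hb : ∀ b, postι m f a 0 b * (postι m f a 0 c ^ (m-1) * postι m f a 0 e) =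
      postι m f a 0 b := by
    intro b
    obtain ⟨y, hy⟩ := post_solve_left m f a hm hf 0 c b
    obtain ⟨j, rfl⟩ : ∃ j, m = j + 1 := ⟨m - 1, by omega⟩
    simp only [Nat.add_sub_cancel] at *
    rw [← hy, mul_assoc, pow_succ (postι (j+1) f a 0 c), mul_assoc, ← mul_assoc (postι (j+1) f a 0 c) (_ ^ _), ← pow_succ', he]
  have key : ∀ k, postι m f a k c ^ (m-1) * postι m f a k e =
      ((FreeMonoid.ofList (List.replicate (m-1) c ++ [e]) : FreeMonoid G) :
        (postCon m f a k).Quotient) := by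
    intro k
    rw [post_coe]; simp
  rw [key, ← Con.coe_one]
  refine (Con.eq _).2 ⟨?_, fun p s hp hs => ?_⟩
  · have : m - 1 + 1 = m := by omega
    simp [this, Nat.ModEq]
  · obtain ⟨q, b, rfl⟩ : ∃ q b, p = q ++ [b] := by
      rcases List.eq_nil_or_concat p with h | ⟨q, b, h⟩
      · simp [h] at hp
      · exact ⟨q, b, by simpa using h⟩
    have h1 := hb b
    rw [key, postι, ← Con.coe_mul] at h1
    have h2 := ((Con.eq _).1 h1).2 q s (Nat.zero_le _) (by
      convert hs using 1
      simp; omega)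
    simpa using h2

theorem post_right_inv (hm : 1 ≤ m) (hf : IsPolyadicGroup (m+1) f)
    (z : (postCon m f a 1).Quotient) : ∃ w, z * w = 1 := by
  induction z using Con.induction_on with
  | H z =>
  induction z using FreeMonoid.inductionOn' with
  | one => exact ⟨1, by simp⟩
  | of_mul c z ih =>
    obtain ⟨w, hw⟩ := ih
    obtain ⟨e, he⟩ := post_one m f a hm hf c
    obtain ⟨x, hx⟩ := post_solve_right m f a hm hf 1 c e
    obtain ⟨j, rfl⟩ : ∃ j, m = j + 1 := ⟨m - 1, by omega⟩
    simp only [Nat.add_sub_cancel] at *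
    refine ⟨w * (postι (j+1) f a 1 c ^ (j + j) * postι (j+1) f a 1 x), ?_⟩
    rw [Con.coe_mul, mul_assoc, ← mul_assoc _ w, hw, one_mul, ← he, ← hx, ← mul_assoc,
      ← mul_assoc, ← pow_add]
    congr 1
    rw [← add_assoc, pow_succ']; rfl

/-- The cover group. -/
@[reducible]
noncomputable def postGroup (hm : 1 ≤ m) (hf : IsPolyadicGroup (m+1) f) :
    Group (postCon m f a 1).Quotient :=
  groupOfIsUnit (fun z => by
    obtain ⟨w, hw⟩ := post_right_inv m f a hm hf z
    obtain ⟨v, hv⟩ := post_right_inv m f a hm hf w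
    have : z = v := by
      calc z = z * (w * v) := by rw [hv, mul_one]
        _ = v := by rw [← mul_assoc, hw, one_mul]
    exact ⟨⟨z, w, hw, by rw [this]; exact hv⟩, rfl⟩)

/-- Degree. -/
def postDeg : (postCon m f a 1).Quotient →* Multiplicative (ZMod m) :=
  (postCon m f a 1).lift
    (FreeMonoid.lift (fun _ => Multiplicative.ofAdd (1 : ZMod m))) (by
      intro u v h
      have h1 := (ZMod.natCast_eq_natCast_iff _ _ _).2 h.1
      have key : ∀ w : FreeMonoid G,
          FreeMonoid.lift (fun _ => Multiplicative.ofAdd (1 : ZMod m)) w =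
            Multiplicative.ofAdd ((w.toList.length : ZMod m)) := by
        intro w
        simp [FreeMonoid.lift_apply, ← ofAdd_nsmul]
      rw [Con.ker_rel, key, key, h1])

theorem postDeg_ι (x : G) : postDeg m f a (postι m f a 1 x) = Multiplicative.ofAdd 1 := by
  simp [postDeg, postι]

theorem post_word (hm : 1 ≤ m) (hA : PolyAssoc (m+1) f) (N : ℕ) :
    ∀ l : List G, l.length = N → l ≠ [] → l.length ≡ 1 [MOD m] →
    ∃ x, (l.map (postι m f a 1)).prod = postι m f a 1 x := by
  induction N using Nat.strong_induction_on with
  | _ N ih =>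
  intro l hN hne hl
  by_cases h : m + 1 ≤ l.length
  · obtain ⟨p1, p2, rfl, h1⟩ : ∃ p1 p2, l = p1 ++ p2 ∧ p1.length = m + 1 :=
      ⟨l.take (m+1), l.drop (m+1), by simp, by simp; omega⟩
    simp only [List.length_append] at *
    obtain ⟨x, hx⟩ := ih (p2.length + 1) (by omega) (postF m f a p1 :: p2) (by simp) (by simp)
      (by
        refine Nat.ModEq.trans ?_ hl
        rw [h1]
        have : m + 1 + p2.length = (p2.length + 1) + m := by ring
        simp [this, Nat.ModEq])
    refine ⟨x, ?_⟩
    rw [← hx, List.map_append, List.prod_append, List.map_cons, List.prod_cons,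
      post_mulF m f a hm hA 1 p1 h1]
  · have h0 : 0 < l.length := List.length_pos_iff.2 hne
    have hd := (Nat.modEq_iff_dvd' (by omega : 1 ≤ l.length)).1 hl.symm
    have : l.length = 1 := by
      have := Nat.eq_zero_of_dvd_of_lt hd (by omega)
      omega
    obtain ⟨x, rfl⟩ := List.length_eq_one_iff.1 this
    exact ⟨x, by simp⟩

theorem post_deg_one (hm : 1 ≤ m) (hf : IsPolyadicGroup (m+1) f)
    (z : (postCon m f a 1).Quotient) (hz : postDeg m f a z = Multiplicative.ofAdd 1) :
    ∃ x, z = postι m f a 1 x := by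
  obtain ⟨e, he⟩ := post_one m f a hm hf a
  induction z using Con.induction_on with
  | H z =>
  have hw : (z : (postCon m f a 1).Quotient) =
      ((z.toList ++ (List.replicate (m-1) a ++ [e])).map (postι m f a 1)).prod := by
    rw [List.map_append, List.prod_append, ← post_coe]
    simp [he]
  have hd : postDeg m f a z = Multiplicative.ofAdd ((z.toList.length : ZMod m)) := by
    simp [postDeg, FreeMonoid.lift_apply, ← ofAdd_nsmul]
  rw [hd] at hz
  have hz' : ((z.toList.length : ℕ) : ZMod m) = ((1 : ℕ) : ZMod m) := by
    simpa using Multiplicative.ofAdd.injective hz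
  rw [ZMod.natCast_eq_natCast_iff] at hz'
  rw [hw]
  refine post_word m f a hm hf.1 _ _ rfl (by simp) ?_
  refine Nat.ModEq.trans ?_ hz'
  have : m - 1 + 1 = m := by omega
  simp [this, Nat.ModEq]

theorem postι_inj (hm : 1 ≤ m) (hf : IsPolyadicGroup (m+1) f) :
    Function.Injective (postι m f a 1) := by
  intro x y h
  have h2 := ((Con.eq _).1 h).2 [a] (List.replicate (m-1) a) (by simp) (by
    have : 1 + 1 + (m - 1) = 1 + m := by omega
    simp [this, Nat.ModEq])
  have key : ∀ z : G, postP m f a ([a] ++ (FreeMonoid.of z).toList ++ List.replicate (m-1) a) =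
      f (Function.update (fun _ => a) ⟨1, by omega⟩ z) := by
    intro z
    have e := postP_collapse0 m f a hm
      ([a] ++ (FreeMonoid.of z).toList ++ List.replicate (m-1) a) [] (by simp; omega)
    rw [List.append_nil] at e
    rw [e, postP, dif_neg (by simp; omega)]
    simp only [List.getD_cons_zero]
    unfold postF
    congr 1
    funext t
    obtain ⟨t, ht⟩ := t
    rcases t with _ | _ | t
    · simp [Function.update, Fin.ext_iff]
    · simp [Function.update, Fin.ext_iff]
    · simp [Function.update, Fin.ext_iff, List.getD_eq_getElem?_getD, List.getElem?_replicate]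
      split_ifs <;> rfl
  rw [key, key] at h2
  exact (hf.2 (fun _ => a) _ ⟨1, by omega⟩).unique h2 rfl

theorem post_retMul (hm : 1 ≤ m) (hA : PolyAssoc (m+1) f) (x y : G) :
    postι m f a 1 (retMul (m+1) f a x y) =
      postι m f a 1 x * postι m f a 1 a ^ (m-1) * postι m f a 1 y := by
  obtain ⟨j, rfl⟩ : ∃ j, m = j + 1 := ⟨m - 1, by omega⟩
  unfold retMul
  rw [post_mulForm _ f a hm hA, List.ofFn_succ, List.prod_cons, List.ofFn_succ',
    List.concat_eq_append, List.prod_append]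
  have : ∀ i : Fin j, (i : ℕ) ≠ j := fun i => i.2.ne
  simp [this, mul_assoc]

end PostAux

/-- Post's coset theorem: every `n`-ary group has a Post cover. -/
theorem post_coset_theorem {G : Type u} [Nonempty G] (n : ℕ) (hn : 2 ≤ n)
    (f : (Fin n → G) → G) (hf : IsPolyadicGroup n f) :
    Nonempty (PostCover n G f) := by
  obtain ⟨m, rfl⟩ : ∃ m, n = m + 1 := ⟨n - 1, by omega⟩
  have hm : 1 ≤ m := by omega
  obtain ⟨a⟩ := ‹Nonempty G›
  have : NeZero m := ⟨by omega⟩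
  letI grp : Group (postCon m f a 1).Quotient := postGroup m f a hm hf
  let D : (postCon m f a 1).Quotient →* Multiplicative (ZMod m) := postDeg m f a
  have hD : ∀ x, D (postι m f a 1 x) = Multiplicative.ofAdd 1 := postDeg_ι m f a
  have hD1 : ∀ z, D z = Multiplicative.ofAdd 1 → ∃ x, z = postι m f a 1 x :=
    post_deg_one m f a hm hf
  have hpow : (Multiplicative.ofAdd (1 : ZMod m)) * (Multiplicative.ofAdd (1 : ZMod m)) ^ (m-1)
      = 1 := by
    rw [← pow_succ', Nat.sub_add_cancel hm, ← ofAdd_nsmul]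
    simp
  have hmemK : ∀ x, postι m f a 1 x * postι m f a 1 a ^ (m-1) ∈ D.ker := by
    intro x
    rw [MonoidHom.mem_ker, map_mul, map_pow, hD, hD, hpow]
  refine ⟨{
    Gs := (postCon m f a 1).Quotient
    grp := grp
    ι := postι m f a 1
    inj := postι_inj m f a hm hf
    K := D.ker
    normal := inferInstance
    coset := ⟨postι m f a 1 a, ?_⟩
    retractIso := ⟨a, Equiv.ofBijective
      (fun x => (⟨postι m f a 1 x * postι m f a 1 a ^ (m-1), hmemK x⟩ : D.ker)) ⟨?_, ?_⟩, ?_⟩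
    cyclicQuot := ⟨QuotientGroup.quotientKerEquivOfSurjective D ?_⟩
    mulForm := post_mulForm m f a hm hf.1 1
    generates := ?_ }⟩
  · ext z
    rw [Set.mem_smul_set_iff_inv_smul_mem, smul_eq_mul, SetLike.mem_coe, MonoidHom.mem_ker,
      map_mul, map_inv, hD, inv_mul_eq_one]
    constructor
    · rintro ⟨x, rfl⟩
      exact (hD x).symm
    · intro h
      obtain ⟨x, hx⟩ := hD1 z h.symm
      exact ⟨x, hx.symm⟩
  · intro x y h
    exact postι_inj m f a hm hf (mul_right_cancel (congrArg Subtype.val h))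
  · rintro ⟨z, hz⟩
    rw [MonoidHom.mem_ker] at hz
    obtain ⟨x, hx⟩ := hD1 (z * (postι m f a 1 a ^ (m-1))⁻¹) (by
      rw [map_mul, hz, map_inv, map_pow, hD, one_mul, inv_eq_iff_mul_eq_one, mul_comm]
      exact hpow)
    refine ⟨x, Subtype.ext ?_⟩
    change postι m f a 1 x * _ = z
    rw [← hx, inv_mul_cancel_right]
  · intro x y
    refine Subtype.ext ?_
    change postι m f a 1 (retMul (m+1) f a x y) * _ =
      (postι m f a 1 x * _) * (postι m f a 1 y * _)
    rw [post_retMul m f a hm hf.1]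
    simp only [mul_assoc]
  · intro z
    refine ⟨postι m f a 1 a ^ (Multiplicative.toAdd z).val, ?_⟩
    rw [map_pow, hD, ← ofAdd_nsmul]
    simp
  · rw [eq_top_iff]
    intro z _
    induction z using Con.induction_on with
    | H z =>
    induction z using FreeMonoid.inductionOn' with
    | one => exact Subgroup.one_mem _
    | of_mul c z ih =>
      have hc : postι m f a 1 c ∈ Subgroup.closure (Set.range (postι m f a 1)) :=
        Subgroup.subset_closure ⟨c, rfl⟩
      exact Subgroup.mul_mem _ hc (ih trivial)
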